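/- Let n ≥ 3 and let B ⊆ E_n be a bipartite graph, i.e. there is a function c : [n] → {0,1} such that every edge {i,j} ∈ B has c(i) ≠ c(j). Write B̄ = E_n \ B. Then: (i) for every odd-cycle-agreeing family F of subgraphs of K_n and every G ∈ F, the graph G Δ B̄ does not belong to F; (ii) for all R, G ⊆ E_n, χ_R(G Δ B̄) = (−1)^(|R|)·(−1)^(|R∩B|)·χ_R(G), where χ_R(S) = (−1)^(|R∩S|); that is, χ_R is an eigenfunction, with eigenvalue (−1)^(|R|)·(−1)^(|R∩B|), of the operator f ↦ (G ↦ f(G Δ B̄)). -/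

import Mathlib

/-- The edge set of the complete graph `K_n` on vertex set `Fin n`:
all non-diagonal unordered pairs. -/
def edgeFinset (n : ℕ) : Finset (Sym2 (Fin n)) :=
  Finset.univ.filter (fun e => ¬ e.IsDiag)

/-- The simple graph on `Fin n` with edge set `G`. -/
def graphOf {n : ℕ} (G : Finset (Sym2 (Fin n))) : SimpleGraph (Fin n) :=
  SimpleGraph.fromEdgeSet (G : Set (Sym2 (Fin n)))

/-- The graph `G` contains a cycle of odd length. -/
def HasOddCycle {n : ℕ} (G : Finset (Sym2 (Fin n))) : Prop :=
  ∃ (v : Fin n) (w : (graphOf G).Walk v v), w.IsCycle ∧ Odd w.length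

/-- A family of graphs is odd-cycle-agreeing if for any two members `G, H`,
the complement (within `E_n`) of the symmetric difference `G Δ H` contains an
odd cycle. -/
def OddCycleAgreeing (n : ℕ) (F : Finset (Finset (Sym2 (Fin n)))) : Prop :=
  ∀ G ∈ F, ∀ H ∈ F, HasOddCycle (edgeFinset n \ ((G \ H) ∪ (H \ G)))

/-- The character `χ_R(S) = (−1)^(|R ∩ S|)`. -/
def chi {n : ℕ} (R S : Finset (Sym2 (Fin n))) : ℝ :=
  (-1 : ℝ) ^ (R ∩ S).card

theorem not_hasOddCycle_of_coloring {n : ℕ} {B : Finset (Sym2 (Fin n))} {c : Fin n → Bool}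
    (hc : ∀ i j : Fin n, s(i, j) ∈ B → c i ≠ c j) : ¬ HasOddCycle B := by
  rintro ⟨v, w, -, hodd⟩
  let C : (graphOf B).Coloring Bool := SimpleGraph.Coloring.mk c fun {i j} hij =>
    hc i j (by simpa using ((SimpleGraph.fromEdgeSet_adj _).mp hij).1)
  exact Nat.not_even_iff_odd.mpr hodd ((C.even_length_iff_congr w).mpr Iff.rfl)

theorem neg_one_pow_card_inter_eq_prod {α : Type*} [DecidableEq α] (R S : Finset α) :
    (-1 : ℝ) ^ (R ∩ S).card = ∏ e ∈ R, if e ∈ S then (-1 : ℝ) else 1 := by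
  rw [Finset.prod_ite_mem, Finset.prod_const]

theorem bipartite_flip_operator
    (n : ℕ) (hn : 3 ≤ n)
    (B : Finset (Sym2 (Fin n))) (hB : B ⊆ edgeFinset n)
    (hbip : ∃ c : Fin n → Bool, ∀ i j : Fin n, s(i, j) ∈ B → c i ≠ c j) :
    (∀ F : Finset (Finset (Sym2 (Fin n))),
        F ⊆ (edgeFinset n).powerset → OddCycleAgreeing n F →
        ∀ G ∈ F,
          ((G \ (edgeFinset n \ B)) ∪ ((edgeFinset n \ B) \ G)) ∉ F) ∧
    (∀ R G : Finset (Sym2 (Fin n)), R ⊆ edgeFinset n → G ⊆ edgeFinset n →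
        chi R ((G \ (edgeFinset n \ B)) ∪ ((edgeFinset n \ B) \ G)) =
          (-1 : ℝ) ^ R.card * (-1 : ℝ) ^ (R ∩ B).card * chi R G) := by
  obtain ⟨c, hc⟩ := hbip
  refine ⟨fun F _ hF G hG hmem => ?_, fun R G hR _ => ?_⟩
  · have hcycle := hF G hG _ hmem
    have heq : edgeFinset n \ ((G \ ((G \ (edgeFinset n \ B)) ∪ ((edgeFinset n \ B) \ G))) ∪
        (((G \ (edgeFinset n \ B)) ∪ ((edgeFinset n \ B) \ G)) \ G)) = B := by
      ext e
      have := @hB e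
      simp only [Finset.mem_sdiff, Finset.mem_union]
      tauto
    rw [heq] at hcycle
    exact not_hasOddCycle_of_coloring hc hcycle
  · simp only [chi, neg_one_pow_card_inter_eq_prod]
    rw [← Finset.prod_const, ← Finset.prod_mul_distrib, ← Finset.prod_mul_distrib]
    refine Finset.prod_congr rfl fun e he => ?_
    have := hR he
    by_cases e ∈ B <;> by_cases e ∈ G <;> simp [*]
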